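/- Let S₀ = ℝ × (0, π) ⊆ ℝ² and 0 < σ < 1. Suppose u is continuous on the closure of S₀, harmonic in S₀, and |u(x₁,x₂)| ≤ e^{−σ|x₁|} on the closure of S₀. Then: (i) there is a constant C such that |∇u(x₁,x₂)| ≤ C min(x₂, π − x₂)^{−1} e^{−σ|x₁|} for all (x₁,x₂) ∈ S₀; (ii) if v is a harmonic conjugate of u on S₀ (∂_{x₁}v = −∂_{x₂}u, ∂_{x₂}v = ∂_{x₁}u), then for each x₂ ∈ (0,π) the limits L₊ = lim_{x₁→+∞} v(x₁,x₂) and L₋ = lim_{x₁→−∞} v(x₁,x₂) exist and do not depend on x₂. -/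

import Mathlib

open Complex Set Filter Topology

/-- Second partial derivatives Laplacian for functions on `ℂ ≃ ℝ²`. -/
noncomputable def lap (f : ℂ → ℝ) (z : ℂ) : ℝ :=
  fderiv ℝ (fun w => fderiv ℝ f w 1) z 1 +
    fderiv ℝ (fun w => fderiv ℝ f w Complex.I) z Complex.I

/-- The gradient of `f : ℂ → ℝ`, viewed as a complex number `(∂₁ f, ∂₂ f)`. -/
noncomputable def gradC (f : ℂ → ℝ) (z : ℂ) : ℂ :=
  (fderiv ℝ f z 1 : ℂ) + (fderiv ℝ f z Complex.I : ℂ) * Complex.I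

/-- `f` is harmonic on `s`: twice continuously differentiable with vanishing Laplacian. -/
def HarmonicOnSet (f : ℂ → ℝ) (s : Set ℂ) : Prop :=
  ContDiffOn ℝ 2 f s ∧ ∀ z ∈ s, lap f z = 0

/-- The horizontal strip `S₀ = ℝ × (0, π)`. -/
def S0 : Set ℂ := {z : ℂ | 0 < z.im ∧ z.im < Real.pi}

open InnerProductSpace MeasureTheory

theorem isOpen_S0 : IsOpen S0 :=
  (isOpen_lt continuous_const Complex.continuous_im).inter
    (isOpen_lt Complex.continuous_im continuous_const)

theorem laplacian_eq_lap {f : ℂ → ℝ} {z : ℂ} (hf : ContDiffAt ℝ 2 f z) :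
    Laplacian.laplacian f z = lap f z := by
  have hd : DifferentiableAt ℝ (fderiv ℝ f) z :=
    (hf.fderiv_right (m := 1) (by norm_num)).differentiableAt (by norm_num)
  rw [laplacian_eq_iteratedFDeriv_complexPlane, lap, fderiv_clm_apply hd (by fun_prop),
    fderiv_clm_apply hd (by fun_prop)]
  simp [iteratedFDeriv_two_apply]

theorem HarmonicOnSet.harmonicOnNhd {f : ℂ → ℝ} {s : Set ℂ} (hs : IsOpen s)
    (hf : HarmonicOnSet f s) : HarmonicOnNhd f s := fun z hz ↦
  ⟨hf.1.contDiffAt (hs.mem_nhds hz), by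
    filter_upwards [hs.mem_nhds hz] with w hw
    rw [laplacian_eq_lap (hf.1.contDiffAt (hs.mem_nhds hw)), hf.2 w hw, Pi.zero_apply]⟩

theorem HarmonicOnSet.differentiableAt {f : ℂ → ℝ} {s : Set ℂ} (hs : IsOpen s)
    (hf : HarmonicOnSet f s) {z : ℂ} (hz : z ∈ s) : DifferentiableAt ℝ f z :=
  (hf.1.contDiffAt (hs.mem_nhds hz)).differentiableAt (by norm_num)

/-- If `u` is locally the real part of a holomorphic `F`, its gradient is the conjugate of `F'`. -/
theorem norm_gradC_eq_norm_deriv {F : ℂ → ℂ} {u : ℂ → ℝ} {z : ℂ} (hF : DifferentiableAt ℂ F z)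
    (hu : (fun w ↦ (F w).re) =ᶠ[𝓝 z] u) : ‖gradC u z‖ = ‖deriv F z‖ := by
  have h : HasFDerivAt (fun w ↦ (F w).re)
      (Complex.reCLM.comp ((fderiv ℂ F z).restrictScalars ℝ)) z :=
    Complex.reCLM.hasFDerivAt.comp z (hF.hasFDerivAt.restrictScalars ℝ)
  rw [← Complex.norm_conj (deriv F z), gradC, (h.congr_of_eventuallyEq hu.symm).fderiv]
  congr 1
  apply Complex.ext <;> simp

/-- Interior gradient estimate for bounded harmonic functions on a disc. -/
theorem norm_gradC_le_of_abs_le {u : ℂ → ℝ} {z : ℂ} {r M : ℝ} (hr : 0 < r) (hM : 0 < M)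
    (hu : HarmonicOnNhd u (Metric.ball z r)) (hb : ∀ w ∈ Metric.ball z r, |u w| ≤ M) :
    ‖gradC u z‖ ≤ 2 * Real.exp 2 * M / r := by
  obtain ⟨F, hF, hFu⟩ := hu.exists_analyticOnNhd_ball_re_eq
  have hz : z ∈ Metric.ball z r := Metric.mem_ball_self hr
  have hFz : DifferentiableAt ℂ F z := (hF z hz).differentiableAt
  rw [norm_gradC_eq_norm_deriv hFz (eventually_of_mem (Metric.ball_mem_nhds z hr) hFu)]
  let G : ℂ → ℂ := fun w ↦ Complex.exp (F w / M)
  have hGn (w : ℂ) (hw : w ∈ Metric.ball z r) : ‖G w‖ = Real.exp (u w / M) := by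
    simp only [G, Complex.norm_exp, Complex.div_ofReal_re]
    rw [← hFu hw]
  have hG1 (w : ℂ) (hw : w ∈ Metric.ball z r) : ‖G w‖ ≤ Real.exp 1 := by
    rw [hGn w hw, Real.exp_le_exp, div_le_one hM]
    exact (le_abs_self _).trans (hb w hw)
  have hG2 : Real.exp (-1) ≤ ‖G z‖ := by
    rw [hGn z hz, Real.exp_le_exp, le_div_iff₀ hM]
    linarith [neg_abs_le (u z), hb z hz]
  have hGd : DifferentiableOn ℂ G (Metric.ball z r) := fun w hw ↦
    ((hF w hw).differentiableAt.div_const _).cexp.differentiableWithinAt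
  have hmaps : MapsTo G (Metric.ball z r) (Metric.closedBall (G z) (2 * Real.exp 1)) := by
    intro w hw
    rw [mem_closedBall_iff_norm]
    linarith [norm_sub_le (G w) (G z), hG1 w hw, hG1 z hz]
  have key := Complex.norm_deriv_le_div_of_mapsTo_ball hGd hmaps hr
  have hGz : HasDerivAt G (G z * (deriv F z / M)) z := (hFz.hasDerivAt.div_const _).cexp
  rw [hGz.deriv, norm_mul, norm_div, Complex.norm_real, Real.norm_of_nonneg hM.le] at key
  have h1 : Real.exp (-1) * (‖deriv F z‖ / M) ≤ 2 * Real.exp 1 / r :=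
    (mul_le_mul_of_nonneg_right hG2 (by positivity)).trans key
  have h2 : ‖deriv F z‖ = Real.exp (-1) * (‖deriv F z‖ / M) * (Real.exp 1 * M) := by
    have : Real.exp (-1) * Real.exp 1 = 1 := by rw [← Real.exp_add]; simp
    field_simp
    linear_combination -‖deriv F z‖ * this
  have h3 : Real.exp 2 = Real.exp 1 * Real.exp 1 := by rw [← Real.exp_add]; norm_num
  rw [h2]
  refine (mul_le_mul_of_nonneg_right h1 (by positivity)).trans_eq ?_
  rw [h3]
  ring

theorem norm_gradC_le_on_S0 {σ : ℝ} (hσ0 : 0 < σ) (hσ1 : σ < 1) {u : ℂ → ℝ}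
    (hh : HarmonicOnSet u S0) (hb : ∀ z ∈ S0, |u z| ≤ Real.exp (-σ * |z.re|)) {z : ℂ}
    (hz : z ∈ S0) :
    ‖gradC u z‖ ≤ 2 * Real.exp 2 * Real.exp Real.pi * (min z.im (Real.pi - z.im))⁻¹ *
      Real.exp (-σ * |z.re|) := by
  set r := min z.im (Real.pi - z.im)
  have hr0 : 0 < r := lt_min hz.1 (sub_pos.2 hz.2)
  have hr1 : r ≤ z.im := min_le_left _ _
  have hr2 : r ≤ Real.pi - z.im := min_le_right _ _
  have hball : Metric.ball z r ⊆ S0 := fun w hw ↦ by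
    have h := (Complex.abs_im_le_norm (w - z)).trans_lt (mem_ball_iff_norm.1 hw)
    rw [Complex.sub_im, abs_lt] at h
    constructor <;> linarith
  have hM (w : ℂ) (hw : w ∈ Metric.ball z r) :
      |u w| ≤ Real.exp Real.pi * Real.exp (-σ * |z.re|) := by
    refine (hb w (hball hw)).trans ?_
    rw [← Real.exp_add, Real.exp_le_exp]
    have h := (Complex.abs_re_le_norm (w - z)).trans_lt (mem_ball_iff_norm.1 hw)
    rw [Complex.sub_re] at h
    have h' := abs_sub_abs_le_abs_sub z.re w.re
    rw [abs_sub_comm] at h'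
    nlinarith [hz.1]
  refine (norm_gradC_le_of_abs_le hr0 (by positivity)
    (fun w hw ↦ hh.harmonicOnNhd isOpen_S0 w (hball hw)) hM).trans_eq ?_
  ring

theorem abs_fderiv_one_le_norm_gradC (u : ℂ → ℝ) (z : ℂ) : |fderiv ℝ u z 1| ≤ ‖gradC u z‖ := by
  simpa [gradC] using Complex.abs_re_le_norm (gradC u z)

theorem abs_fderiv_I_le_norm_gradC (u : ℂ → ℝ) (z : ℂ) :
    |fderiv ℝ u z Complex.I| ≤ ‖gradC u z‖ := by
  simpa [gradC] using Complex.abs_im_le_norm (gradC u z)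

theorem exists_tendsto_atTop_of_hasDerivAt_le_exp {f f' : ℝ → ℝ} {σ K : ℝ} (hσ : 0 < σ)
    (hf : ∀ x, HasDerivAt f (f' x) x) (hb : ∀ x, |f' x| ≤ K * Real.exp (-σ * |x|)) :
    ∃ L, Tendsto f atTop (𝓝 L) := by
  refine ⟨_, tendsto_limUnder_of_hasDerivAt_of_integrableOn_Ioi (a := 0) (f' := f')
    (fun x _ ↦ hf x) ?_⟩
  refine Integrable.mono' ((exp_neg_integrableOn_Ioi 0 hσ).const_mul K) ?_ ?_
  · rw [← funext fun x ↦ (hf x).deriv]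
    exact aestronglyMeasurable_deriv f _
  · filter_upwards [ae_restrict_mem measurableSet_Ioi] with x hx
    simpa [abs_of_pos (mem_Ioi.1 hx)] using hb x

theorem exists_tendsto_atBot_of_hasDerivAt_le_exp {f f' : ℝ → ℝ} {σ K : ℝ} (hσ : 0 < σ)
    (hf : ∀ x, HasDerivAt f (f' x) x) (hb : ∀ x, |f' x| ≤ K * Real.exp (-σ * |x|)) :
    ∃ L, Tendsto f atBot (𝓝 L) := by
  obtain ⟨L, hL⟩ := exists_tendsto_atTop_of_hasDerivAt_le_exp (f := fun x ↦ f (-x))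
    (f' := fun x ↦ -f' (-x)) (K := K) hσ
    (fun x ↦ by simpa [Function.comp_def] using! (hf (-x)).scomp x (hasDerivAt_neg x))
    (fun x ↦ by simpa using hb (-x))
  exact ⟨L, by simpa [Function.comp_def] using hL.comp tendsto_neg_atBot_atTop⟩

theorem tendsto_exp_neg_mul_abs_cocompact {σ : ℝ} (hσ : 0 < σ) :
    Tendsto (fun x : ℝ ↦ Real.exp (-σ * |x|)) (cocompact ℝ) (𝓝 0) :=
  Real.tendsto_exp_atBot.comp
    ((tendsto_norm_cocompact_atTop (E := ℝ)).const_mul_atTop_of_neg (neg_lt_zero.2 hσ))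

theorem mem_S0_iff (x y : ℝ) :
    (x : ℂ) + (y : ℂ) * Complex.I ∈ S0 ↔ 0 < y ∧ y < Real.pi := by
  simp [S0]

/-- for `u` harmonic on `S₀ = ℝ × (0,π)`, continuous on the closure, with
`|u| ≤ e^{−σ|x₁|}`: (i) `|∇u(x)| ≤ C min(x₂,π−x₂)⁻¹ e^{−σ|x₁|}` in `S₀`; (ii) any harmonic
conjugate `v` of `u` has limits `L₊`, `L₋` as `x₁ → ±∞`, independent of `x₂ ∈ (0,π)`. -/
theorem statement14 (σ : ℝ) (hσ0 : 0 < σ) (hσ1 : σ < 1)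
    (u : ℂ → ℝ)
    (hc : ContinuousOn u (closure S0))
    (hh : HarmonicOnSet u S0)
    (hb : ∀ z ∈ closure S0, |u z| ≤ Real.exp (-σ * |z.re|)) :
    (∃ C : ℝ, ∀ z ∈ S0,
      ‖gradC u z‖ ≤ C * (min z.im (Real.pi - z.im))⁻¹ * Real.exp (-σ * |z.re|)) ∧
    (∀ v : ℂ → ℝ,
      HarmonicOnSet v S0 →
      (∀ z ∈ S0, fderiv ℝ v z 1 = -(fderiv ℝ u z Complex.I) ∧
        fderiv ℝ v z Complex.I = fderiv ℝ u z 1) →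
      ∃ Lp Lm : ℝ, ∀ x₂ : ℝ, 0 < x₂ → x₂ < Real.pi →
        Tendsto (fun x₁ : ℝ => v ((x₁ : ℂ) + (x₂ : ℂ) * Complex.I)) atTop (𝓝 Lp) ∧
        Tendsto (fun x₁ : ℝ => v ((x₁ : ℂ) + (x₂ : ℂ) * Complex.I)) atBot (𝓝 Lm)) := by
  have hS := isOpen_S0
  have grad {z : ℂ} (hz : z ∈ S0) := norm_gradC_le_on_S0 hσ0 hσ1 hh
    (fun w hw ↦ hb w (subset_closure hw)) hz
  set C := 2 * Real.exp 2 * Real.exp Real.pi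
  have hC0 : 0 < C := by positivity
  refine ⟨⟨C, fun z hz ↦ grad hz⟩, fun v hv hcr ↦ ?_⟩
  have hderiv_re (x y : ℝ) (hy : (x : ℂ) + (y : ℂ) * Complex.I ∈ S0) :
      HasDerivAt (fun t : ℝ ↦ v ((t : ℂ) + (y : ℂ) * Complex.I))
        (-fderiv ℝ u ((x : ℂ) + (y : ℂ) * Complex.I) Complex.I) x := by
    rw [← (hcr _ hy).1]
    exact (hv.differentiableAt hS hy).hasFDerivAt.comp_hasDerivAt x
      ((hasDerivAt_id x).ofReal_comp.add_const _)
  have hderiv_im (x y : ℝ) (hy : (x : ℂ) + (y : ℂ) * Complex.I ∈ S0) :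
      HasDerivAt (fun t : ℝ ↦ v ((x : ℂ) + (t : ℂ) * Complex.I))
        (fderiv ℝ u ((x : ℂ) + (y : ℂ) * Complex.I) 1) y := by
    rw [← (hcr _ hy).2]
    refine (hv.differentiableAt hS hy).hasFDerivAt.comp_hasDerivAt y ?_
    simpa using ((hasDerivAt_id y).ofReal_comp.mul_const Complex.I).const_add (x : ℂ)
  have hpi := Real.pi_pos
  have hmid (x : ℝ) : (x : ℂ) + ((Real.pi / 2 : ℝ) : ℂ) * Complex.I ∈ S0 :=
    (mem_S0_iff _ _).2 ⟨by linarith, by linarith⟩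
  have hmid_le (x : ℝ) :
      |-fderiv ℝ u ((x : ℂ) + ((Real.pi / 2 : ℝ) : ℂ) * Complex.I) Complex.I| ≤
        C * (min (Real.pi / 2) (Real.pi - Real.pi / 2))⁻¹ * Real.exp (-σ * |x|) := by
    rw [abs_neg]
    refine (abs_fderiv_I_le_norm_gradC _ _).trans ((grad (hmid x)).trans_eq ?_)
    simp
  obtain ⟨Lp, hLp⟩ := exists_tendsto_atTop_of_hasDerivAt_le_exp hσ0
    (fun x ↦ hderiv_re x _ (hmid x)) hmid_le
  obtain ⟨Lm, hLm⟩ := exists_tendsto_atBot_of_hasDerivAt_le_exp hσ0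
    (fun x ↦ hderiv_re x _ (hmid x)) hmid_le
  refine ⟨Lp, Lm, fun y hy0 hy1 ↦ ?_⟩
  obtain ⟨d, hd0, hdy, hyd⟩ : ∃ d, 0 < d ∧ d ≤ y ∧ y ≤ Real.pi - d :=
    ⟨min y (Real.pi - y), lt_min hy0 (sub_pos.2 hy1), min_le_left _ _,
      le_sub_comm.1 (min_le_right _ _)⟩
  have hdiff (x : ℝ) : ‖v ((x : ℂ) + (y : ℂ) * Complex.I) -
      v ((x : ℂ) + ((Real.pi / 2 : ℝ) : ℂ) * Complex.I)‖ ≤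
        C * d⁻¹ * Real.exp (-σ * |x|) * ‖y - Real.pi / 2‖ := by
    have hmem (t : ℝ) (ht : t ∈ Icc d (Real.pi - d)) : (x : ℂ) + (t : ℂ) * Complex.I ∈ S0 :=
      (mem_S0_iff _ _).2 ⟨by linarith [ht.1], by linarith [ht.2]⟩
    refine (convex_Icc d (Real.pi - d)).norm_image_sub_le_of_norm_hasDerivWithin_le
      (f := fun t : ℝ ↦ v ((x : ℂ) + (t : ℂ) * Complex.I))
      (fun t ht ↦ (hderiv_im x t (hmem t ht)).hasDerivWithinAt) (fun t ht ↦ ?_)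
      ⟨by linarith, by linarith⟩ ⟨hdy, hyd⟩
    refine (abs_fderiv_one_le_norm_gradC _ _).trans ((grad (hmem t ht)).trans ?_)
    have hdt : d ≤ min t (Real.pi - t) := le_min ht.1 (le_sub_comm.1 ht.2)
    simp only [add_re, ofReal_re, mul_re, I_re, mul_zero, ofReal_im, I_im, sub_self, add_zero,
      add_im, mul_im, mul_one, zero_add]
    gcongr
  have hlim : Tendsto (fun x : ℝ ↦ v ((x : ℂ) + (y : ℂ) * Complex.I) -
      v ((x : ℂ) + ((Real.pi / 2 : ℝ) : ℂ) * Complex.I)) (cocompact ℝ) (𝓝 0) := by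
    refine squeeze_zero_norm hdiff ?_
    simpa using ((tendsto_exp_neg_mul_abs_cocompact hσ0).const_mul (C * d⁻¹)).mul_const
      ‖y - Real.pi / 2‖
  exact ⟨by simpa using (hlim.mono_left atTop_le_cocompact).add hLp,
    by simpa using (hlim.mono_left atBot_le_cocompact).add hLm⟩
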